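/- arXiv:1307.4670 — 3 statements merged into one kernel-verified Lean document; each statement's English description precedes it below -/
import Mathlib

section
/- Let G be a connected finite simple graph of order n > 2 with Laplacian eigenvalues λ₁ ≥ ⋯ ≥ λₙ. Let U ⊂ V with |U| = m < n such that the induced subgraph G[U] consists of r pairwise disjoint edges and m − 2r isolated vertices. Then λ₁ + ⋯ + λₘ ≥ (∑_{u∈U} d_u) + m − r. -/
open Finset

theorem ky_arith (n m : ℕ) (hmn : m < n) (lam p : Fin n → ℝ)
    (hanti : ∀ i j : Fin n, i ≤ j → lam j ≤ lam i) (h0 : ∀ i, 0 ≤ lam i)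
    (p0 : ∀ i, 0 ≤ p i) (p1 : ∀ i, p i ≤ 1) (ps : ∑ i, p i ≤ m) :
    ∑ i, lam i * p i ≤ ∑ i ∈ Finset.filter (fun i : Fin n => (i : ℕ) < m) Finset.univ, lam i := by
  set t := lam ⟨m, hmn⟩ with ht
  have hc : ((Finset.filter (fun i : Fin n => (i : ℕ) < m) Finset.univ).card : ℝ) = m := by
    have := Fin.card_filter_val_lt (n := n) (m := m)
    rw [this, min_eq_right hmn.le]
  have hm : ∑ i : Fin n, (if (i:ℕ) < m then (1:ℝ) else 0) = m := by
    rw [← hc]; simp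
  rw [Finset.sum_filter]
  have key : ∀ i : Fin n, lam i * p i + t * ((if (i:ℕ) < m then (1:ℝ) else 0) - p i) ≤
      (if (i:ℕ) < m then lam i else 0) := by
    intro i
    split_ifs with h
    · have := hanti i ⟨m, hmn⟩ (by rw [Fin.le_def]; exact h.le)
      nlinarith [p1 i]
    · have := hanti ⟨m, hmn⟩ i (by rw [Fin.le_def]; simpa using h)
      nlinarith [p0 i]
  have := Finset.sum_le_sum (fun i (_ : i ∈ (Finset.univ : Finset (Fin n))) => key i)
  rw [Finset.sum_add_distrib, ← Finset.mul_sum, Finset.sum_sub_distrib, hm] at this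
  nlinarith [h0 ⟨m, hmn⟩]

theorem ky_abs (n : ℕ) (B : OrthonormalBasis (Fin n) ℝ (EuclideanSpace ℝ (Fin n)))
    (lam : Fin n → ℝ) (hanti : ∀ i j : Fin n, i ≤ j → lam j ≤ lam i) 
    (U : Finset (Fin n)) (hmn : U.card < n)
    (y : Fin n → EuclideanSpace ℝ (Fin n))
    (hy : ∀ f, ∑ u ∈ U, (inner ℝ (y u) f)^2 ≤ ∑ i, lam i * (inner ℝ (B i) f)^2) :
    ∑ u ∈ U, ‖y u‖^2 ≤
      ∑ i ∈ Finset.filter (fun i : Fin n => (i : ℕ) < U.card) Finset.univ, lam i := by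
  have h1 : ∀ i, ∑ u ∈ U, (inner ℝ (y u) (B i))^2 ≤ lam i := by
    intro i
    refine (hy (B i)).trans (le_of_eq ?_)
    simp [B.inner_eq_ite]
  have h0 : ∀ i, 0 ≤ lam i := fun i => le_trans (Finset.sum_nonneg fun _ _ => sq_nonneg _) (h1 i)
  have hz : ∀ i, ∀ u ∈ U, lam i * ((inner ℝ (y u) (B i))^2 / lam i) = (inner ℝ (y u) (B i))^2 := by
    intro i u hu
    by_cases hl : lam i = 0
    · have : (inner ℝ (y u) (B i))^2 ≤ lam i :=
        (Finset.single_le_sum (f := fun u => (inner ℝ (y u) (B i))^2)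
          (fun _ _ => sq_nonneg _) hu).trans (h1 i)
      have := le_antisymm (this.trans hl.le) (sq_nonneg _)
      rw [this]; simp
    · field_simp
  have h2 : ∀ u ∈ U, ∑ i, (inner ℝ (y u) (B i))^2 / lam i ≤ 1 := by
    intro u hu
    set f : EuclideanSpace ℝ (Fin n) := ∑ i, (inner ℝ (y u) (B i) / lam i) • B i with hf
    have e1 : inner ℝ (y u) f = ∑ i, (inner ℝ (y u) (B i))^2 / lam i := by
      rw [hf, inner_sum]
      refine Finset.sum_congr rfl fun i _ => ?_
      rw [inner_smul_right]; ring
    have e2 : ∀ i, inner ℝ (B i) f = inner ℝ (y u) (B i) / lam i := by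
      intro i
      rw [hf, inner_sum]
      simp [inner_smul_right, B.inner_eq_ite]
    have h := (Finset.single_le_sum (f := fun u => (inner ℝ (y u) f)^2)
          (fun _ _ => sq_nonneg _) hu).trans (hy f)
    have e3 : ∑ i, lam i * (inner ℝ (B i) f)^2 = ∑ i, (inner ℝ (y u) (B i))^2 / lam i := by
      refine Finset.sum_congr rfl fun i _ => ?_
      rw [e2]
      by_cases hl : lam i = 0
      · simp [hl]
      · field_simp
    rw [e3] at h
    simp only [e1] at h
    by_contra hcon
    push Not at hcon
    nlinarith
  have := ky_arith n U.card hmn lam (fun i => ∑ u ∈ U, (inner ℝ (y u) (B i))^2 / lam i) hanti h0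
    (fun i => Finset.sum_nonneg fun u _ => div_nonneg (sq_nonneg _) (h0 i))
    (fun i => by rw [← Finset.sum_div]; exact div_le_one_of_le₀ (h1 i) (h0 i))
    (by rw [Finset.sum_comm]; refine (Finset.sum_le_sum h2).trans ?_; simp)
  refine le_trans (le_of_eq ?_) this
  simp_rw [Finset.mul_sum]
  rw [Finset.sum_comm]
  refine Finset.sum_congr rfl fun u hu => ?_
  rw [← B.sum_sq_norm_inner_left (y u)]
  refine Finset.sum_congr rfl fun i _ => ?_
  rw [hz i u hu]; simp

theorem quad_eig (n : ℕ) (L : Matrix (Fin n) (Fin n) ℝ) (hL : L.IsHermitian)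
    (f : EuclideanSpace ℝ (Fin n)) :
    f.ofLp ⬝ᵥ (L.mulVec f.ofLp) = ∑ i, hL.eigenvalues i * (inner ℝ (hL.eigenvectorBasis i) f)^2 := by
  have h := hL.eigenvectorBasis.sum_inner_mul_inner (WithLp.toLp 2 (L.mulVec f.ofLp)) f
  have e : inner ℝ (WithLp.toLp 2 (L.mulVec f.ofLp)) f = f.ofLp ⬝ᵥ (L.mulVec f.ofLp) := by
    simp [EuclideanSpace.inner_eq_star_dotProduct]
  rw [← e, ← h]
  refine Finset.sum_congr rfl fun i _ => ?_
  have hT : L.transpose = L := (by simpa using hL : L.IsSymm)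
  have : inner ℝ (WithLp.toLp 2 (L.mulVec f.ofLp)) (hL.eigenvectorBasis i)
      = hL.eigenvalues i * inner ℝ (hL.eigenvectorBasis i) f := by
    simp only [EuclideanSpace.inner_eq_star_dotProduct, star_trivial]
    rw [Matrix.dotProduct_mulVec, ← Matrix.mulVec_transpose, hT, hL.mulVec_eigenvectorBasis]
    simp [dotProduct_comm]
  rw [this]; ring

theorem gm_nonempty (n : ℕ) (hn : 2 < n) (G : SimpleGraph (Fin n)) [DecidableRel G.Adj]
    (hconn : G.Connected) (U : Finset (Fin n))
    (hmatching : ∀ u ∈ U, ∀ v ∈ U, ∀ w ∈ U, G.Adj u v → G.Adj u w → v = w)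
    (k : Fin n → ℕ) (hk : ∀ u v, k u < k v → G.degree u ≤ G.degree v) (u : Fin n) (hu : u ∈ U) :
    ∃ v, G.Adj u v ∧ (v ∉ U ∨ ¬ k v < k u) := by
  by_contra hcon
  push Not at hcon
  have boundary : ∀ S : Finset (Fin n), u ∈ S → S.card ≤ 2 → ∃ a ∈ S, ∃ b ∉ S, G.Adj a b := by
    intro S hS hc
    obtain ⟨w, hw⟩ : ∃ w, w ∉ S := by
      by_contra h
      push Not at h
      have : S = univ := by ext; simp [h]
      rw [this] at hc
      simp at hc
      omega
    obtain ⟨p⟩ := hconn.preconnected u w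
    obtain ⟨d, -, h1, h2⟩ := p.exists_boundary_dart (S : Set (Fin n)) (by simpa using hS)
      (by simpa using hw)
    exact ⟨d.fst, by simpa using h1, d.snd, by simpa using h2, d.adj⟩
  obtain ⟨a, ha, v, -, hav⟩ := boundary {u} (by simp) (by simp)
  rw [Finset.mem_singleton] at ha
  subst ha
  have hv := hcon v hav
  have hdu : G.degree a ≤ 1 := by
    rw [← G.card_neighborFinset_eq_degree, Finset.card_le_one]
    intro x hx y hy
    rw [G.mem_neighborFinset] at hx hy
    exact hmatching a hu x (hcon x hx).1 y (hcon y hy).1 hx hy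
  have hdv : G.degree v ≤ 1 := (hk _ _ hv.2).trans hdu
  rw [← G.card_neighborFinset_eq_degree, Finset.card_le_one] at hdu hdv
  simp only [G.mem_neighborFinset] at hdu hdv
  obtain ⟨x, hx, z, hz, hxz⟩ := boundary {a, v} (by simp) Finset.card_le_two
  simp only [Finset.mem_insert, Finset.mem_singleton, not_or] at hx hz
  rcases hx with rfl | rfl
  · exact hz.2 (hdu _ hxz _ hav)
  · exact hz.1 (hdv _ hxz _ hav.symm)

/-- star vector -/
noncomputable def gmY (n : ℕ) (u : Fin n) (S : Finset (Fin n)) : EuclideanSpace ℝ (Fin n) :=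
  (√(S.card : ℝ))⁻¹ • ∑ v ∈ S, (EuclideanSpace.single u (1:ℝ) - EuclideanSpace.single v (1:ℝ))

theorem gmY_inner (n : ℕ) (u : Fin n) (S : Finset (Fin n)) (f : EuclideanSpace ℝ (Fin n)) :
    inner ℝ (gmY n u S) f = (√(S.card : ℝ))⁻¹ * ∑ v ∈ S, (f u - f v) := by
  rw [gmY, real_inner_smul_left, sum_inner]
  simp [inner_sub_left, EuclideanSpace.inner_single_left]

theorem gmY_inner_sq (n : ℕ) (u : Fin n) (S : Finset (Fin n)) (f : EuclideanSpace ℝ (Fin n)) :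
    (inner ℝ (gmY n u S) f)^2 ≤ ∑ v ∈ S, (f u - f v)^2 := by
  rw [gmY_inner, mul_pow, inv_pow, Real.sq_sqrt (by positivity)]
  rcases S.eq_empty_or_nonempty with rfl | hS
  · simp
  have hp : (0:ℝ) < S.card := by exact_mod_cast hS.card_pos
  rw [inv_mul_le_iff₀ hp]
  exact sq_sum_le_card_mul_sum_sq

theorem gmY_norm (n : ℕ) (u : Fin n) (S : Finset (Fin n)) (hu : u ∉ S) (hS : S.Nonempty) :
    ‖gmY n u S‖^2 = S.card + 1 := by
  have hp : (0:ℝ) < S.card := by exact_mod_cast hS.card_pos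
  have hval : ∀ w, gmY n u S w = (√(S.card : ℝ))⁻¹ *
      ((if w = u then (S.card:ℝ) else 0) - if w ∈ S then 1 else 0) := by
    intro w
    simp [gmY, PiLp.single_apply, Finset.sum_sub_distrib]
  rw [← real_inner_self_eq_norm_sq, gmY_inner]
  have : ∀ v ∈ S, gmY n u S u - gmY n u S v
     = (√(S.card : ℝ))⁻¹ * (S.card + 1) := by
    intro v hv
    have : v ≠ u := fun h => hu (h ▸ hv)
    rw [hval, hval]
    simp [hu, hv, this]
    ring
  rw [Finset.sum_congr rfl this]
  simp only [sum_const, nsmul_eq_mul]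
  have h2 : (√(S.card : ℝ))⁻¹ * (√(S.card : ℝ))⁻¹ = (S.card : ℝ)⁻¹ := by
    rw [← mul_inv, Real.mul_self_sqrt hp.le]
  calc _ = ((√(S.card : ℝ))⁻¹ * (√(S.card : ℝ))⁻¹) * (S.card * (S.card + 1)) := by ring
    _ = _ := by rw [h2]; field_simp

theorem gm_quad (n : ℕ) (G : SimpleGraph (Fin n)) [DecidableRel G.Adj] (U : Finset (Fin n))
    (k : Fin n → ℕ) (hk : Function.Injective k) (f : Fin n → ℝ) :
    ∑ u ∈ U, ∑ v ∈ univ.filter (fun v => G.Adj u v ∧ (v ∉ U ∨ ¬ k v < k u)), (f u - f v)^2 ≤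
      f ⬝ᵥ ((G.lapMatrix ℝ).mulVec f) := by
  rw [← Matrix.toLinearMap₂'_apply', SimpleGraph.lapMatrix_toLinearMap₂']
  set T : Fin n → Fin n → ℝ := fun u v =>
    if u ∈ U ∧ G.Adj u v ∧ (v ∉ U ∨ ¬ k v < k u) then (f u - f v)^2 else 0 with hT
  have e : ∑ u ∈ U, ∑ v ∈ univ.filter (fun v => G.Adj u v ∧ (v ∉ U ∨ ¬ k v < k u)), (f u - f v)^2
      = ∑ u, ∑ v, T u v := by
    rw [← Finset.sum_subset (Finset.subset_univ U)]
    · refine Finset.sum_congr rfl fun u hu => ?_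
      rw [Finset.sum_filter]
      simp [hT, hu]
    · intro u _ hu
      simp [hT, hu]
  have e2 : ∑ u, ∑ v, T u v = ∑ u, ∑ v, T v u := Finset.sum_comm
  have h : ∑ u, ∑ v, T u v + ∑ u, ∑ v, T v u ≤
      ∑ i, ∑ j, if G.Adj i j then (f i - f j) ^ 2 else 0 := by
    rw [← Finset.sum_add_distrib]
    refine Finset.sum_le_sum fun u _ => ?_
    rw [← Finset.sum_add_distrib]
    refine Finset.sum_le_sum fun v _ => ?_
    simp only [hT]
    by_cases ha : G.Adj u v
    · have hne : k u ≠ k v := fun h => ha.ne (hk h)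
      have hs : (f v - f u)^2 = (f u - f v)^2 := by ring
      have h0 := sq_nonneg (f u - f v)
      simp only [ha, ha.symm, true_and, if_true, hs]
      split_ifs with h1 h2 <;> first | linarith | (exfalso; grind)
    · have : ¬ G.Adj v u := fun h => ha h.symm
      simp [ha, this]
  rw [e]
  linarith

theorem gm_count (n : ℕ) (G : SimpleGraph (Fin n)) [DecidableRel G.Adj] (U : Finset (Fin n))
    (k : Fin n → ℕ) (hk : Function.Injective k) (r : ℕ)
    (hr : ((Finset.univ : Finset (Fin n × Fin n)).filter
      (fun p => p.1 ∈ U ∧ p.2 ∈ U ∧ G.Adj p.1 p.2)).card = 2 * r) :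
    ∑ u ∈ U, G.degree u =
    ∑ u ∈ U, (univ.filter (fun v => G.Adj u v ∧ (v ∉ U ∨ ¬ k v < k u))).card + r := by
  set A := (Finset.univ : Finset (Fin n × Fin n)).filter
      (fun p => p.1 ∈ U ∧ p.2 ∈ U ∧ G.Adj p.1 p.2) with hA
  have hsplit := Finset.card_filter_add_card_filter_not (s := A) (fun p => k p.2 < k p.1)
  have hsw : (A.filter (fun p => k p.2 < k p.1)).card = (A.filter (fun p => ¬ k p.2 < k p.1)).card := by
    refine Finset.card_bij (fun p _ => p.swap) ?_ ?_ ?_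
    · rintro ⟨a, b⟩ h
      simp only [hA, mem_filter, mem_univ, true_and, Prod.swap] at h ⊢
      exact ⟨⟨h.1.2.1, h.1.1, h.1.2.2.symm⟩, by omega⟩
    · intro a _ b _ h
      exact Prod.swap_injective h
    · rintro ⟨a, b⟩ h
      simp only [hA, mem_filter, mem_univ, true_and] at h
      have hne : k a ≠ k b := fun h' => h.1.2.2.ne (hk h')
      refine ⟨(b, a), ?_, rfl⟩
      simp only [hA, mem_filter, mem_univ, true_and]
      exact ⟨⟨h.1.2.1, h.1.1, h.1.2.2.symm⟩, by omega⟩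
  have hr' : (A.filter (fun p => k p.2 < k p.1)).card = r := by omega
  have hsum : (A.filter (fun p => k p.2 < k p.1)).card
      = ∑ u ∈ U, (univ.filter (fun v => G.Adj u v ∧ ¬ (v ∉ U ∨ ¬ k v < k u))).card := by
    rw [← Finset.card_sigma]
    refine Finset.card_bij (fun p _ => ⟨p.1, p.2⟩) ?_ ?_ ?_
    · rintro ⟨a, b⟩ h
      simp only [hA, mem_filter, mem_univ, true_and, mem_sigma] at h ⊢
      tauto
    · rintro ⟨a, b⟩ _ ⟨c, d⟩ _ h
      simpa using h
    · rintro ⟨a, b⟩ h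
      simp only [hA, mem_filter, mem_univ, true_and, mem_sigma] at h
      refine ⟨(a, b), ?_, rfl⟩
      simp only [hA, mem_filter, mem_univ, true_and]
      tauto
  rw [← hr', hsum, ← Finset.sum_add_distrib]
  refine Finset.sum_congr rfl fun u _ => ?_
  rw [← Finset.filter_filter, ← Finset.filter_filter, Finset.card_filter_add_card_filter_not,
    ← G.card_neighborFinset_eq_degree]
  congr 1
  ext v
  simp

/-- Grone–Merris bound: if `G[U]` consists of `r` pairwise disjoint edges and
`m - 2r` isolated vertices, then `∑_{i≤m} λᵢ ≥ ∑_{u∈U} d_u + m - r`. -/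
theorem stmt8 (n : ℕ) (hn : 2 < n) (G : SimpleGraph (Fin n)) [DecidableRel G.Adj]
    (hconn : G.Connected)
    (hL : (G.lapMatrix ℝ).IsHermitian)
    (lam : Fin n → ℝ) (σ : Equiv.Perm (Fin n))
    (hlam : lam = hL.eigenvalues ∘ σ)
    (hlamAnti : ∀ i j : Fin n, i ≤ j → lam j ≤ lam i)
    (U : Finset (Fin n)) (m : ℕ) (hU : U.card = m) (hmn : m < n)
    (r : ℕ)
    -- every vertex of `U` has at most one neighbour inside `U`,
    -- i.e. the edges of `G[U]` are pairwise disjoint: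
    (hmatching : ∀ u ∈ U, ∀ v ∈ U, ∀ w ∈ U, G.Adj u v → G.Adj u w → v = w)
    -- there are exactly `r` such edges (`2r` ordered adjacent pairs inside `U`):
    (hr : ((Finset.univ : Finset (Fin n × Fin n)).filter
      (fun p => p.1 ∈ U ∧ p.2 ∈ U ∧ G.Adj p.1 p.2)).card = 2 * r) :
    (∑ u ∈ U, (G.degree u : ℝ)) + (m : ℝ) - (r : ℝ) ≤
      ∑ i ∈ Finset.filter (fun i : Fin n => (i : ℕ) < m) Finset.univ, lam i := by
  set k : Fin n → ℕ := fun u => G.degree u * n + u with hkdef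
  have hk1 : ∀ u v, k u < k v → G.degree u ≤ G.degree v := by
    intro u v h
    by_contra hc
    push Not at hc
    have h1 : (G.degree v + 1) * n ≤ G.degree u * n := Nat.mul_le_mul_right n hc
    have h2 := v.isLt
    simp only [hkdef] at h
    rw [add_mul] at h1
    omega
  have hk2 : Function.Injective k := by
    intro u v h
    have h' := congrArg (· % n) h
    simp only [hkdef] at h'
    rw [mul_comm, Nat.mul_add_mod, mul_comm, Nat.mul_add_mod, Nat.mod_eq_of_lt u.isLt,
      Nat.mod_eq_of_lt v.isLt] at h'
    exact Fin.ext h'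
  set S : Fin n → Finset (Fin n) :=
    fun u => univ.filter (fun v => G.Adj u v ∧ (v ∉ U ∨ ¬ k v < k u)) with hS
  have hne : ∀ u ∈ U, (S u).Nonempty := by
    intro u hu
    obtain ⟨v, hv⟩ := gm_nonempty n hn G hconn U hmatching k hk1 u hu
    exact ⟨v, by simpa [hS] using hv⟩
  have hcount := gm_count n G U k hk2 r hr
  have hcountR : ∑ u ∈ U, (G.degree u : ℝ) = ∑ u ∈ U, ((S u).card : ℝ) + r := by
    exact_mod_cast hcount
  have main := ky_abs n (hL.eigenvectorBasis.reindex σ.symm) lam hlamAnti U (by omega)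
    (fun u => gmY n u (S u)) (by
      intro f
      have h1 := gm_quad n G U k hk2 f.ofLp
      rw [quad_eig n _ hL f, ← Equiv.sum_comp σ] at h1
      refine le_trans (Finset.sum_le_sum fun u _ => gmY_inner_sq n u (S u) f) (h1.trans ?_)
      simp [hlam])
  rw [hU] at main
  refine le_trans (le_of_eq ?_) main
  rw [Finset.sum_congr rfl (fun u hu => gmY_norm n u (S u) (by simp [hS]) (hne u hu)),
    Finset.sum_add_distrib, hcountR]
  simp [hU]
  ring
end

section
/- Let G be a connected finite simple graph of order n > 2 with Laplacian eigenvalues λ₁ ≥ ⋯ ≥ λₙ. For any vertex subset U ⊂ V with |U| = m < n, letting E[U] denote the edge set of the induced subgraph G[U], we have λ₁ + ⋯ + λₘ ≥ (∑_{u∈U} d_u) + m − |E[U]|. -/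
open Finset

lemma aux_abstract {ι : Type*} (n m : ℕ) (hmn : m < n) (lam : Fin n → ℝ)
    (h0 : ∀ i, 0 ≤ lam i) (hanti : ∀ i j : Fin n, i ≤ j → lam j ≤ lam i)
    (U : Finset ι) (hU : U.card = m) (B : ι → Fin n → ℝ)
    (hB : ∀ y : Fin n → ℝ, ∑ u ∈ U, (∑ i, y i * B u i) ^ 2 ≤ ∑ i, lam i * y i ^ 2) :
    ∑ u ∈ U, ∑ i, (B u i) ^ 2 ≤
      ∑ i ∈ Finset.filter (fun i : Fin n => (i : ℕ) < m) Finset.univ, lam i := by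
  have h1 : ∀ i, ∑ u ∈ U, (B u i) ^ 2 ≤ lam i := by
    intro i
    have := hB (Pi.single i 1)
    simpa [Pi.single_apply, ite_pow] using this
  have hBz : ∀ u ∈ U, ∀ i, lam i = 0 → B u i = 0 := by
    intro u hu i hi
    have h2 := h1 i
    have h3 := Finset.single_le_sum (f := fun u => (B u i) ^ 2) (fun u _ => sq_nonneg _) hu
    have : (B u i) ^ 2 = 0 := le_antisymm (by linarith) (sq_nonneg _)
    simpa using this
  have h2 : ∀ u ∈ U, ∑ i, (B u i) ^ 2 / lam i ≤ 1 := by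
    intro u hu
    set t := ∑ i, (B u i) ^ 2 / lam i with ht
    have h3 := hB (fun i => B u i / lam i)
    have h4 := Finset.single_le_sum (f := fun w => (∑ i, B u i / lam i * B w i) ^ 2)
      (fun u _ => sq_nonneg _) hu
    have h5 : ∑ i, B u i / lam i * B u i = t := by
      rw [ht]; refine Finset.sum_congr rfl fun i _ => by ring
    have h6 : ∑ i, lam i * (B u i / lam i) ^ 2 = t := by
      rw [ht]; refine Finset.sum_congr rfl fun i _ => ?_
      by_cases h : lam i = 0
      · simp [h]
      · field_simp
    rw [h5] at h4
    rw [h6] at h3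
    nlinarith
  set c : Fin n → ℝ := fun i => ∑ u ∈ U, (B u i) ^ 2 / lam i with hc
  have hc0 : ∀ i, 0 ≤ c i := fun i =>
    Finset.sum_nonneg fun u _ => div_nonneg (sq_nonneg _) (h0 i)
  have hc1 : ∀ i, c i ≤ 1 := by
    intro i
    simp only [hc]
    rw [← Finset.sum_div]
    exact div_le_one_of_le₀ (h1 i) (h0 i)
  have hcm : ∑ i, c i ≤ m := by
    simp only [hc]
    rw [Finset.sum_comm]
    calc _ ≤ ∑ u ∈ U, (1 : ℝ) := Finset.sum_le_sum h2
      _ = m := by simp [hU]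
  have hE : ∑ u ∈ U, ∑ i, (B u i) ^ 2 = ∑ i, lam i * c i := by
    rw [Finset.sum_comm]
    refine Finset.sum_congr rfl fun i _ => ?_
    simp only [hc]
    rw [Finset.mul_sum]
    refine Finset.sum_congr rfl fun u hu => ?_
    by_cases h : lam i = 0
    · simp [h, hBz u hu i h]
    · field_simp
  rw [hE]
  set μ := lam ⟨m, hmn⟩ with hμ
  have key : ∀ i : Fin n, (lam i - μ) * c i ≤ if (i : ℕ) < m then lam i - μ else 0 := by
    intro i
    split_ifs with h
    · have := hanti i ⟨m, hmn⟩ (by rw [Fin.le_def]; simp; omega)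
      nlinarith [hc1 i]
    · have := hanti ⟨m, hmn⟩ i (by rw [Fin.le_def]; simp; omega)
      nlinarith [hc0 i]
  have hs := Finset.sum_le_sum fun i (_ : i ∈ (Finset.univ : Finset (Fin n))) => key i
  rw [← Finset.sum_filter, Finset.sum_sub_distrib] at hs
  have hcard : (Finset.filter (fun i : Fin n => (i : ℕ) < m) Finset.univ).card = m := by
    rw [Fin.card_filter_val_lt]; omega
  simp only [sub_mul, Finset.sum_sub_distrib, ← Finset.mul_sum, Finset.sum_const, hcard,
    nsmul_eq_mul] at hs
  have : μ * ∑ i, c i ≤ μ * m := mul_le_mul_of_nonneg_left hcm (h0 _)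
  nlinarith

/-- diagonalization -/
lemma aux_diag (n : ℕ) (A : Matrix (Fin n) (Fin n) ℝ) (hL : A.IsHermitian) :
    ∃ v : Fin n → Fin n → ℝ, (∀ w : Fin n → ℝ, ∑ i, (∑ j, v i j * w j) ^ 2 = ∑ j, w j ^ 2) ∧
      (∀ y : Fin n → ℝ, (fun j => ∑ i, y i * v i j) ⬝ᵥ (A.mulVec (fun j => ∑ i, y i * v i j)) =
        ∑ i, hL.eigenvalues i * y i ^ 2) := by
  have hon : ∀ i k, ∑ j, hL.eigenvectorBasis i j * hL.eigenvectorBasis k j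
      = if i = k then 1 else 0 := by
    intro i k
    have := orthonormal_iff_ite.1 hL.eigenvectorBasis.orthonormal i k
    rw [← this]
    simp [PiLp.inner_apply, mul_comm]
  refine ⟨fun i j => hL.eigenvectorBasis i j, ?_, ?_⟩
  · intro w
    have := hL.eigenvectorBasis.sum_sq_norm_inner_right (WithLp.toLp 2 w)
    rw [EuclideanSpace.norm_sq_eq] at this
    simpa [PiLp.inner_apply, mul_comm] using this
  · intro y
    have e1 : (fun j => ∑ i, y i * hL.eigenvectorBasis i j)
        = ∑ i, y i • (hL.eigenvectorBasis i).ofLp := by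
      ext j; simp
    have e2 : A.mulVec (fun j => ∑ i, y i * hL.eigenvectorBasis i j)
        = ∑ i, (y i * hL.eigenvalues i) • (hL.eigenvectorBasis i).ofLp := by
      rw [e1, Matrix.mulVec_sum]
      refine Finset.sum_congr rfl fun i _ => ?_
      rw [Matrix.mulVec_smul, hL.mulVec_eigenvectorBasis, smul_smul]
    rw [e2, e1, sum_dotProduct]
    refine Finset.sum_congr rfl fun i _ => ?_
    rw [dotProduct_sum]
    have : ∀ k, (y i • (hL.eigenvectorBasis i).ofLp) ⬝ᵥ
        ((y k * hL.eigenvalues k) • (hL.eigenvectorBasis k).ofLp)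
        = if i = k then y i * (y k * hL.eigenvalues k) else 0 := by
      intro k
      rw [smul_dotProduct, dotProduct_smul]
      simp only [dotProduct, hon, smul_eq_mul]
      split_ifs <;> ring
    simp only [this]
    simp
    ring

lemma aux_key (n : ℕ) (G : SimpleGraph (Fin n)) (hconn : G.Connected)
    (U : Finset (Fin n)) (hU : U.card < n) :
    ∃ key : Fin n → ℕ, Function.Injective key ∧
      ∀ u ∈ U, ∃ v, G.Adj u v ∧ key v < key u := by
  obtain ⟨r, hr⟩ : ∃ r, r ∉ U := by
    by_contra! h
    have : U = Finset.univ := Finset.eq_univ_iff_forall.2 h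
    simp [this] at hU
  refine ⟨fun i => G.dist i r * n + i, ?_, ?_⟩
  · intro i j h
    have h' := congrArg (· % n) h
    simp only [Nat.mul_add_mod_self_right, Nat.mod_eq_of_lt i.2, Nat.mod_eq_of_lt j.2] at h'
    exact Fin.ext h'
  · intro u hu
    obtain ⟨p, hp⟩ := hconn.exists_walk_length_eq_dist u r
    cases p with
    | nil => exact absurd hu hr
    | @cons _ v _ h q =>
      refine ⟨v, h, ?_⟩
      have h1 := SimpleGraph.dist_le q
      simp only [SimpleGraph.Walk.length_cons] at hp
      have h2 : G.dist v r + 1 ≤ G.dist u r := by omega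
      have := Nat.mul_le_mul_right n h2
      have := v.2
      simp only
      nlinarith

theorem stmt10 (n : ℕ) (hn : 2 < n) (G : SimpleGraph (Fin n)) [DecidableRel G.Adj]
    (hconn : G.Connected)
    (hL : (G.lapMatrix ℝ).IsHermitian)
    (lam : Fin n → ℝ) (σ : Equiv.Perm (Fin n))
    (hlam : lam = hL.eigenvalues ∘ σ)
    (hlamAnti : ∀ i j : Fin n, i ≤ j → lam j ≤ lam i)
    (U : Finset (Fin n)) (m : ℕ) (hU : U.card = m) (hmn : m < n) :
    (∑ u ∈ U, (G.degree u : ℝ)) + (m : ℝ) -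
      (((Finset.univ : Finset (Fin n × Fin n)).filter
        (fun p => p.1 ∈ U ∧ p.2 ∈ U ∧ G.Adj p.1 p.2)).card : ℝ) / 2 ≤
      ∑ i ∈ Finset.filter (fun i : Fin n => (i : ℕ) < m) Finset.univ, lam i := by
  classical
  obtain ⟨key, hinj, hkey⟩ := aux_key n G hconn U (by omega)
  obtain ⟨v, hv1, hv2⟩ := aux_diag n _ hL
  set S : Fin n → Finset (Fin n) := fun u =>
    Finset.univ.filter (fun w => G.Adj u w ∧ (w ∉ U ∨ key w < key u)) with hS
  have hSpos : ∀ u ∈ U, (0 : ℝ) < (S u).card := by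
    intro u hu
    obtain ⟨w, h1, h2⟩ := hkey u hu
    exact_mod_cast Finset.card_pos.2 ⟨w, by simp [hS, h1, h2]⟩
  have hSself : ∀ u, u ∉ S u := by intro u; simp [hS]
  -- the star vectors
  set W : Fin n → Fin n → ℝ := fun u j =>
    (if j = u then ((S u).card : ℝ) else 0) - (if j ∈ S u then 1 else 0) with hW
  have hWdot : ∀ u (x : Fin n → ℝ), ∑ j, W u j * x j = ∑ w ∈ S u, (x u - x w) := by
    intro u x
    simp [hW, sub_mul, Finset.sum_sub_distrib]
  have hWsq : ∀ u, ∑ j, W u j ^ 2 = ((S u).card : ℝ) ^ 2 + (S u).card := by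
    intro u
    have : ∀ j, W u j ^ 2 = (if j = u then ((S u).card : ℝ) ^ 2 else 0)
        + (if j ∈ S u then 1 else 0) := by
      intro j
      simp only [hW]
      by_cases h : j = u
      · subst h; simp [hSself]
      · by_cases h' : j ∈ S u <;> simp [h, h']
    simp [this, Finset.sum_add_distrib]
  -- quadratic form bound
  have hquad : ∀ x : Fin n → ℝ, ∑ u ∈ U, (∑ j, W u j * x j) ^ 2 / (S u).card ≤
      x ⬝ᵥ ((G.lapMatrix ℝ).mulVec x) := by
    intro x
    have hlap : x ⬝ᵥ ((G.lapMatrix ℝ).mulVec x)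
        = (∑ i, ∑ j, if G.Adj i j then (x i - x j) ^ 2 else 0) / 2 := by
      rw [← SimpleGraph.lapMatrix_toLinearMap₂', Matrix.toLinearMap₂'_apply']
    rw [hlap]
    set T : Fin n → Fin n → ℝ := fun i j =>
      if i ∈ U ∧ j ∈ S i then (x i - x j) ^ 2 else 0 with hT
    have s1 : ∑ u ∈ U, (∑ j, W u j * x j) ^ 2 / (S u).card ≤ ∑ i, ∑ j, T i j := by
      have : ∑ i, ∑ j, T i j = ∑ u ∈ U, ∑ w ∈ S u, (x u - x w) ^ 2 := by
        simp [hT, ite_and, Finset.sum_ite_mem]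
      rw [this]
      refine Finset.sum_le_sum fun u hu => ?_
      rw [hWdot, div_le_iff₀ (hSpos u hu), mul_comm]
      exact sq_sum_le_card_mul_sum_sq
    have s2 : ∑ i, ∑ j, T i j = (∑ i, ∑ j, (T i j + T j i)) / 2 := by
      have : ∑ i, ∑ j, T j i = ∑ i, ∑ j, T i j := Finset.sum_comm
      simp only [Finset.sum_add_distrib, this]
      ring
    rw [s2] at s1
    refine s1.trans ?_
    gcongr with i _ j _
    simp only [hT, hS, Finset.mem_filter, Finset.mem_univ, true_and, G.adj_comm j i]
    have hp := sq_nonneg (x i - x j)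
    have hq : (x j - x i) ^ 2 = (x i - x j) ^ 2 := by ring
    rw [hq]
    split_ifs <;> first | linarith | (exfalso; grind)
  -- counting
  have hcount : ∑ u ∈ U, ((S u).card : ℝ) = ∑ u ∈ U, (G.degree u : ℝ) -
      (((Finset.univ : Finset (Fin n × Fin n)).filter
        (fun p => p.1 ∈ U ∧ p.2 ∈ U ∧ G.Adj p.1 p.2)).card : ℝ) / 2 := by
    set R : Fin n → Fin n → ℝ := fun i j =>
      if i ∈ U ∧ j ∈ U ∧ G.Adj i j ∧ key i < key j then 1 else 0 with hR
    have c1 : (((Finset.univ : Finset (Fin n × Fin n)).filter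
        (fun p => p.1 ∈ U ∧ p.2 ∈ U ∧ G.Adj p.1 p.2)).card : ℝ)
        = ∑ i, ∑ j, (R i j + R j i) := by
      rw [Finset.card_filter, Fintype.sum_prod_type]
      push_cast
      refine Finset.sum_congr rfl fun i _ => Finset.sum_congr rfl fun j _ => ?_
      simp only [hR, G.adj_comm j i]
      have : G.Adj i j → key i ≠ key j := fun h h' => h.ne (hinj h')
      split_ifs <;> first | (norm_num; done) | (exfalso; grind)
    have c2 : ∑ i, ∑ j, (R i j + R j i) = 2 * ∑ i, ∑ j, R i j := by
      have : ∑ i, ∑ j, R j i = ∑ i, ∑ j, R i j := Finset.sum_comm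
      simp only [Finset.sum_add_distrib, this]
      ring
    have c3 : ∑ i, ∑ j, R i j = ∑ i ∈ U, ∑ j, R i j := by
      symm
      apply Finset.sum_subset (Finset.subset_univ _)
      intro i _ hi
      simp [hR, hi]
    rw [c1, c2, c3, mul_div_cancel_left₀ _ (by norm_num : (2:ℝ) ≠ 0), ← Finset.sum_sub_distrib]
    refine Finset.sum_congr rfl fun u hu => ?_
    rw [← G.card_neighborFinset_eq_degree, G.neighborFinset_eq_filter, eq_sub_iff_add_eq]
    simp only [hS, Finset.card_filter]
    push_cast
    rw [← Finset.sum_add_distrib]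
    refine Finset.sum_congr rfl fun j _ => ?_
    simp only [hR]
    have : G.Adj u j → key u ≠ key j := fun h h' => h.ne (hinj h')
    split_ifs <;> first | (norm_num; done) | (exfalso; grind)
  have h0 : ∀ i, 0 ≤ lam i := by
    intro i
    rw [hlam]
    exact (G.posSemidef_lapMatrix ℝ).eigenvalues_nonneg _
  have main := aux_abstract n m hmn lam h0 hlamAnti U hU
    (fun u i => (∑ j, v (σ i) j * W u j) / Real.sqrt (S u).card) (by
      intro y
      have hq := hquad (fun j => ∑ i, y (σ.symm i) * v i j)
      rw [hv2 (fun i => y (σ.symm i))] at hq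
      have e1 : ∑ i, lam i * y i ^ 2 = ∑ i, hL.eigenvalues i * y (σ.symm i) ^ 2 := by
        rw [← Equiv.sum_comp σ.symm]
        simp [hlam]
      rw [e1]
      refine le_trans (le_of_eq ?_) hq
      refine Finset.sum_congr rfl fun u hu => ?_
      rw [← Equiv.sum_comp σ.symm]
      simp only [Equiv.apply_symm_apply, mul_div_assoc', ← Finset.sum_div]
      rw [div_pow, Real.sq_sqrt (hSpos u hu).le]
      congr 2
      simp only [Finset.mul_sum]
      rw [Finset.sum_comm]
      refine Finset.sum_congr rfl fun j _ => Finset.sum_congr rfl fun i _ => by ring)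
  refine le_trans (le_of_eq ?_) main
  have hfin : ∀ u ∈ U, ∑ i, ((∑ j, v (σ i) j * W u j) / Real.sqrt (S u).card) ^ 2
      = (S u).card + 1 := by
    intro u hu
    have hp := hSpos u hu
    simp only [div_pow, Real.sq_sqrt hp.le]
    rw [← Finset.sum_div, Equiv.sum_comp σ (fun i => (∑ j, v i j * W u j) ^ 2), hv1, hWsq]
    field_simp
  rw [Finset.sum_congr rfl hfin, Finset.sum_add_distrib, hcount]
  simp [hU]
  ring
end

section
/- Let G be a connected finite simple graph of order n > 2 with Laplacian eigenvalues λ₁ ≥ ⋯ ≥ λₙ. Let U ⊂ V with |U| = m < n, and let ϑ₁ be the largest Laplacian eigenvalue of the induced subgraph G[Ū] on the complement of U. Then λ₁ + ⋯ + λ_{m+1} ≥ (∑_{u∈U} d_u) + m − |E[U]| + ϑ₁. -/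
open Finset

lemma weighted_le (n m : ℕ) (hmn : m < n) (lam t : Fin n → ℝ)
    (hanti : ∀ i j : Fin n, i ≤ j → lam j ≤ lam i) (h0 : ∀ i, 0 ≤ lam i)
    (t0 : ∀ i, 0 ≤ t i) (t1 : ∀ i, t i ≤ 1) (ht : ∑ i, t i ≤ (m : ℝ) + 1) :
    ∑ i, lam i * t i ≤
      ∑ i ∈ Finset.filter (fun i : Fin n => (i : ℕ) < m + 1) Finset.univ, lam i := by
  set μ := lam ⟨m, hmn⟩ with hμ
  have hc : ∑ i : Fin n, (if (i : ℕ) < m + 1 then (1 : ℝ) else 0) = m + 1 := by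
    rw [Fin.sum_univ_eq_sum_range (fun i => if i < m + 1 then (1 : ℝ) else 0) n,
      ← Finset.sum_filter]
    have : (Finset.range n).filter (fun i => i < m + 1) = Finset.range (m + 1) := by
      ext i; simp; omega
    rw [this]; simp
  rw [Finset.sum_filter]
  have key : 0 ≤ ∑ i : Fin n, ((if (i : ℕ) < m + 1 then (1 : ℝ) else 0) - t i) * (lam i - μ) := by
    apply Finset.sum_nonneg
    intro i _
    split_ifs with h
    · have : μ ≤ lam i := hanti i ⟨m, hmn⟩ (by simp [Fin.le_def]; omega)
      exact mul_nonneg (by linarith [t1 i]) (by linarith)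
    · have : lam i ≤ μ := hanti ⟨m, hmn⟩ i (by simp [Fin.le_def]; omega)
      exact mul_nonneg_of_nonpos_of_nonpos (by linarith [t0 i]) (by linarith)
  have e : ∑ i : Fin n, ((if (i : ℕ) < m + 1 then (1 : ℝ) else 0) - t i) * (lam i - μ)
      = ∑ i : Fin n, (if (i : ℕ) < m + 1 then lam i else 0) - ∑ i, lam i * t i
        - μ * (∑ i : Fin n, (if (i : ℕ) < m + 1 then (1 : ℝ) else 0) - ∑ i, t i) := by
    rw [← Finset.sum_sub_distrib, ← Finset.sum_sub_distrib, Finset.mul_sum,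
      ← Finset.sum_sub_distrib]
    refine Finset.sum_congr rfl fun i _ => ?_
    split_ifs <;> ring
  rw [e, hc] at key
  have := mul_nonneg (h0 ⟨m, hmn⟩) (sub_nonneg.2 ht)
  linarith

lemma kyfan {E W ι : Type*} [NormedAddCommGroup E] [InnerProductSpace ℝ E]
    [NormedAddCommGroup W] [InnerProductSpace ℝ W] [FiniteDimensional ℝ W]
    [FiniteDimensional ℝ E] [Fintype ι]
    (n m : ℕ) (hmn : m < n) (A : W →ₗ[ℝ] E) (v : OrthonormalBasis (Fin n) ℝ W)
    (lam : Fin n → ℝ)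
    (hanti : ∀ i j : Fin n, i ≤ j → lam j ≤ lam i)
    (hA : ∀ i j, inner ℝ (A (v i)) (A (v j)) = if i = j then lam i else 0)
    (F : ι → E) (z : ι → W) (b : ι → ℝ) (hF0 : ∀ i, F i ≠ 0) (hz0 : ∀ i, z i ≠ 0)
    (hF : ∀ i j, i ≠ j → inner ℝ (F i) (F j) = 0)
    (hb : ∀ i, b i * (‖F i‖ ^ 2 * ‖z i‖ ^ 2) ≤ (inner ℝ (F i) (A (z i))) ^ 2)
    (hι : Fintype.card ι ≤ m + 1) :
    ∑ i, b i ≤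
      ∑ i ∈ Finset.filter (fun i : Fin n => (i : ℕ) < m + 1) Finset.univ, lam i := by
  have hlam : ∀ i, lam i = ‖A (v i)‖ ^ 2 := fun i => by
    rw [← real_inner_self_eq_norm_sq, hA i i, if_pos rfl]
  have h0 : ∀ i, 0 ≤ lam i := fun i => by rw [hlam]; positivity
  set f : ι → E := fun i => (‖F i‖⁻¹ : ℝ) • F i with hf
  have hfo : Orthonormal ℝ f := by
    constructor
    · intro i
      simp [hf, norm_smul, hF0 i]
    · intro i j hij
      simp [hf, inner_smul_left, inner_smul_right, hF i j hij]
  have hzero : ∀ j, lam j = 0 → A (v j) = 0 := fun j h => by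
    rw [hlam] at h; simpa using h
  set t : Fin n → ℝ := fun j => ∑ i, (inner ℝ (f i) (A (v j))) ^ 2 / lam j with ht
  have hlt : ∀ j, lam j * t j = ∑ i, (inner ℝ (f i) (A (v j))) ^ 2 := fun j => by
    simp only [ht]
    rw [Finset.mul_sum]
    refine Finset.sum_congr rfl fun i _ => ?_
    by_cases h : lam j = 0
    · simp [hzero j h]
    · field_simp
  have t0 : ∀ j, 0 ≤ t j := fun j =>
    Finset.sum_nonneg fun i _ => div_nonneg (sq_nonneg _) (h0 j)
  have t1 : ∀ j, t j ≤ 1 := fun j => by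
    by_cases h : lam j = 0
    · simp [ht, h]
    · simp only [ht]
      rw [← Finset.sum_div, div_le_one (lt_of_le_of_ne (h0 j) (Ne.symm h)), hlam]
      have := hfo.sum_inner_products_le (A (v j)) (s := Finset.univ)
      simpa [Real.norm_eq_abs, sq_abs] using this
  have ts : ∑ j, t j ≤ (m : ℝ) + 1 := by
    simp only [ht]
    rw [Finset.sum_comm]
    have : ∀ i, ∑ j, (inner ℝ (f i) (A (v j))) ^ 2 / lam j ≤ 1 := by
      intro i
      set g : {j // lam j ≠ 0} → E := fun j => ((√(lam j))⁻¹ : ℝ) • A (v j) with hg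
      have hgo : Orthonormal ℝ g := by
        rw [orthonormal_iff_ite]
        intro j k
        simp only [hg, inner_smul_left, inner_smul_right, hA, Subtype.ext_iff]
        split_ifs with h
        · rw [← h]
          have h2 := Real.mul_self_sqrt (h0 j)
          have h3 : √(lam j) ≠ 0 := fun h => j.2 (by rw [← h2, h]; simp)
          simp
          field_simp
          nlinarith
        · simp
      have h1 := hgo.sum_inner_products_le (f i) (s := Finset.univ)
      rw [hfo.1 i] at h1
      refine le_trans (le_of_eq ?_) (h1.trans (by norm_num))
      have e1 : ∑ j, (inner ℝ (f i) (A (v j))) ^ 2 / lam j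
          = ∑ j ∈ Finset.univ.filter (fun j => lam j ≠ 0),
            (inner ℝ (f i) (A (v j))) ^ 2 / lam j := by
        symm
        apply Finset.sum_filter_of_ne
        intro j _ h h'
        exact h (by simp [h'])
      rw [e1, Finset.sum_subtype (p := fun j => lam j ≠ 0) _ (by simp)]
      refine Finset.sum_congr rfl fun j _ => ?_
      simp only [hg, inner_smul_left, real_inner_comm, Real.norm_eq_abs, sq_abs, mul_pow]
      have h2 := Real.sq_sqrt (h0 j)
      simp [h2]
      rw [div_eq_inv_mul]
    calc _ ≤ ∑ i : ι, (1 : ℝ) := Finset.sum_le_sum fun i _ => this i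
      _ = Fintype.card ι := by simp
      _ ≤ _ := by exact_mod_cast hι
  refine le_trans ?_ (weighted_le n m hmn lam t hanti h0 t0 t1 ts)
  simp only [hlt]
  rw [Finset.sum_comm]
  refine Finset.sum_le_sum fun i _ => ?_
  have e : ∑ j, (inner ℝ (f i) (A (v j))) ^ 2 = ‖A.adjoint (f i)‖ ^ 2 := by
    rw [← v.sum_sq_norm_inner_left]
    refine Finset.sum_congr rfl fun j _ => ?_
    rw [LinearMap.adjoint_inner_left]
    simp
  rw [e]
  have hcs := real_inner_mul_inner_self_le (A.adjoint (f i)) (z i)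
  rw [LinearMap.adjoint_inner_left, real_inner_self_eq_norm_sq, real_inner_self_eq_norm_sq] at hcs
  have hz := norm_pos_iff.2 (hz0 i)
  have hFp := norm_pos_iff.2 (hF0 i)
  have h1 : inner ℝ (f i) (A (z i)) = ‖F i‖⁻¹ * inner ℝ (F i) (A (z i)) := by
    simp [hf, inner_smul_left]
  rw [h1] at hcs
  have h2 : b i * ‖z i‖ ^ 2 ≤ ‖F i‖⁻¹ * inner ℝ (F i) (A (z i)) * (‖F i‖⁻¹ * inner ℝ (F i) (A (z i))) := by
    have : ‖F i‖⁻¹ * inner ℝ (F i) (A (z i)) * (‖F i‖⁻¹ * inner ℝ (F i) (A (z i))) = (inner ℝ (F i) (A (z i)))^2 / ‖F i‖^2 := by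
      field_simp
    rw [this, le_div_iff₀ (by positivity)]
    linarith [hb i]
  exact le_of_mul_le_mul_right (h2.trans hcs) (by positivity)

lemma orient_sum {V : Type*} (G : SimpleGraph V) [DecidableRel G.Adj]
    (D : V → V → Prop) [DecidableRel D]
    (hD : ∀ a b, G.Adj a b ↔ D a b ∨ D b a) (hD' : ∀ a b, D a b → ¬ D b a)
    (S : Finset V) (g : V → V → ℝ) (hg : ∀ a b, g a b = g b a) :
    ∑ a ∈ S, ∑ b ∈ S, (if D a b then g a b else 0)
      = (∑ a ∈ S, ∑ b ∈ S, if G.Adj a b then g a b else 0) / 2 := by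
  have h : ∑ a ∈ S, ∑ b ∈ S, (if G.Adj a b then g a b else 0)
      = ∑ a ∈ S, ∑ b ∈ S, (if D a b then g a b else 0)
        + ∑ a ∈ S, ∑ b ∈ S, (if D b a then g b a else 0) := by
    simp only [← Finset.sum_add_distrib]
    refine Finset.sum_congr rfl fun a _ => Finset.sum_congr rfl fun b _ => ?_
    have := hD a b
    have := hD' a b
    have := hD' b a
    rw [hg b a]
    by_cases h1 : D a b <;> by_cases h2 : D b a <;> simp_all
  rw [h, Finset.sum_comm (f := fun a b => if D b a then g b a else 0)]
  ring

lemma exists_orient (n : ℕ) (G : SimpleGraph (Fin n)) (hconn : G.Connected)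
    (U : Finset (Fin n)) (hU : U.card < n) :
    ∃ D : Fin n → Fin n → Prop, (∀ a b, G.Adj a b ↔ D a b ∨ D b a) ∧
      (∀ a b, D a b → ¬ D b a) ∧ (∀ a b, D a b → b ∈ U → a ∈ U) ∧
      (∀ u ∈ U, ∃ b, D u b) := by
  obtain ⟨r, hr⟩ : ∃ r, r ∉ U := by
    by_contra! h
    have : U = Finset.univ := by ext; simp [h]
    simp [this] at hU
  set d : Fin n → ℕ := fun a => if a ∈ U then G.dist a r else 0 with hd
  have hpos : ∀ u ∈ U, 0 < G.dist u r := fun u hu =>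
    hconn.pos_dist_of_ne (fun h => hr (h ▸ hu))
  have hlt : ∀ a b, d b < d a → n * d b + b < n * d a + a := by
    intro a b h
    have := b.2
    have : n * (d b + 1) ≤ n * d a := Nat.mul_le_mul_left n h
    nlinarith
  refine ⟨fun a b => G.Adj a b ∧ n * d b + b < n * d a + a, ?_, ?_, ?_, ?_⟩
  · intro a b
    constructor
    · intro h
      rcases lt_trichotomy (n * d b + b) (n * d a + a) with h1 | h1 | h1
      · exact Or.inl ⟨h, h1⟩
      · exfalso
        rcases lt_trichotomy (d b) (d a) with h2 | h2 | h2
        · have := hlt _ _ h2; omega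
        · rw [h2] at h1
          exact h.ne (Fin.ext (by omega))
        · have := hlt _ _ h2; omega
      · exact Or.inr ⟨h.symm, h1⟩
    · rintro (h | h)
      · exact h.1
      · exact h.1.symm
  · intro a b h h'
    omega
  · intro a b h hb
    by_contra ha
    have : d a < d b := by simp [hd, ha, hb, hpos b hb]
    have := hlt _ _ this
    omega
  · intro u hu
    obtain ⟨p, hp⟩ := hconn.exists_walk_length_eq_dist u r
    have hpu := hpos u hu
    cases p with
    | nil => exact absurd hu hr
    | cons h q =>
      rename_i b
      refine ⟨b, h, hlt _ _ ?_⟩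
      have h1 := SimpleGraph.dist_le q
      simp at hp
      simp only [hd, hu, if_true]
      split_ifs <;> omega

noncomputable def incMap (n : ℕ) (D : Fin n → Fin n → Prop) [DecidableRel D] :
    EuclideanSpace ℝ (Fin n) →ₗ[ℝ] EuclideanSpace ℝ (Fin n × Fin n) where
  toFun x := WithLp.toLp 2 fun p => if D p.1 p.2 then x p.1 - x p.2 else 0
  map_add' x y := by
    ext p; simp; split_ifs <;> ring
  map_smul' c x := by
    ext p; simp; try (split_ifs <;> ring)

lemma incMap_inner (n : ℕ) (G : SimpleGraph (Fin n)) [DecidableRel G.Adj]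
    (D : Fin n → Fin n → Prop) [DecidableRel D]
    (hD : ∀ a b, G.Adj a b ↔ D a b ∨ D b a) (hD' : ∀ a b, D a b → ¬ D b a)
    (x y : EuclideanSpace ℝ (Fin n)) :
    inner ℝ (incMap n D x) (incMap n D y) =
      (x : Fin n → ℝ) ⬝ᵥ (Matrix.mulVec (G.lapMatrix ℝ) y) := by
  have hq : ∀ x : EuclideanSpace ℝ (Fin n), inner ℝ (incMap n D x) (incMap n D x) =
      (x : Fin n → ℝ) ⬝ᵥ (Matrix.mulVec (G.lapMatrix ℝ) x) := by
    intro x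
    rw [← Matrix.toLinearMap₂'_apply', SimpleGraph.lapMatrix_toLinearMap₂',
      ← orient_sum G D hD hD' Finset.univ (fun a b => (x a - x b) ^ 2) (fun a b => by ring),
      ← Finset.sum_product']
    simp only [PiLp.inner_apply, incMap]
    refine Finset.sum_congr rfl fun p _ => ?_
    simp
  have h := hq (x + y)
  have hs : (y : Fin n → ℝ) ⬝ᵥ (Matrix.mulVec (G.lapMatrix ℝ) x)
      = (x : Fin n → ℝ) ⬝ᵥ (Matrix.mulVec (G.lapMatrix ℝ) y) := by
    rw [Matrix.dotProduct_mulVec, ← Matrix.mulVec_transpose,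
      (SimpleGraph.isSymm_lapMatrix ℝ G).eq, dotProduct_comm]
  rw [map_add, inner_add_left, inner_add_right, inner_add_right, hq, hq, WithLp.ofLp_add,
    Matrix.mulVec_add, add_dotProduct, dotProduct_add, dotProduct_add, hs,
    real_inner_comm (incMap n D x) (incMap n D y)] at h
  linarith

lemma star_count (n : ℕ) (G : SimpleGraph (Fin n)) [DecidableRel G.Adj]
    (D : Fin n → Fin n → Prop) [DecidableRel D]
    (hD : ∀ a b, G.Adj a b ↔ D a b ∨ D b a) (hD' : ∀ a b, D a b → ¬ D b a)
    (U : Finset (Fin n)) (hDU : ∀ a b, D a b → b ∈ U → a ∈ U) :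
    ∑ u ∈ U, (∑ b, if D u b then (1 : ℝ) else 0) = (∑ u ∈ U, (G.degree u : ℝ)) -
      (((Finset.univ : Finset (Fin n × Fin n)).filter
        (fun p => p.1 ∈ U ∧ p.2 ∈ U ∧ G.Adj p.1 p.2)).card : ℝ) / 2 := by
  have h1 : (((Finset.univ : Finset (Fin n × Fin n)).filter
        (fun p => p.1 ∈ U ∧ p.2 ∈ U ∧ G.Adj p.1 p.2)).card : ℝ)
      = ∑ a ∈ U, ∑ b ∈ U, if G.Adj a b then (1 : ℝ) else 0 := by
    rw [← Finset.sum_product', ← Finset.sum_filter, Finset.sum_const, nsmul_eq_mul, mul_one]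
    congr 2
    ext p
    simp [and_assoc]
  rw [h1, ← orient_sum G D hD hD' U (fun _ _ => 1) (fun _ _ => rfl), Finset.sum_comm (s := U) (t := U),
    ← Finset.sum_sub_distrib]
  refine Finset.sum_congr rfl fun u hu => ?_
  rw [SimpleGraph.degree_eq_sum_if_adj, eq_sub_iff_add_eq]
  have h2 : ∑ b ∈ U, (if D b u then (1 : ℝ) else 0) = ∑ b, (if D b u then (1 : ℝ) else 0) := by
    apply Finset.sum_subset (Finset.subset_univ _)
    intro b _ hb
    rw [if_neg (fun h => hb (hDU b u h hu))]
  rw [h2, ← Finset.sum_add_distrib]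
  refine Finset.sum_congr rfl fun b _ => ?_
  have := hD u b
  have := hD' u b
  by_cases h1 : D u b <;> by_cases h2 : D b u <;> simp_all

noncomputable def starF (n : ℕ) (D : Fin n → Fin n → Prop) [DecidableRel D] (u : Fin n) :
    EuclideanSpace ℝ (Fin n × Fin n) :=
  WithLp.toLp 2 fun p => if p.1 = u then (if D u p.2 then 1 else 0) else 0

noncomputable def starZ (n : ℕ) (D : Fin n → Fin n → Prop) [DecidableRel D] (u : Fin n) :
    EuclideanSpace ℝ (Fin n) :=
  WithLp.toLp 2 fun c => (if c = u then (∑ b, if D u b then (1 : ℝ) else 0) else 0)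
    - if D u c then 1 else 0

lemma starF_inner (n : ℕ) (D : Fin n → Fin n → Prop) [DecidableRel D] (u : Fin n)
    (X : EuclideanSpace ℝ (Fin n × Fin n)) :
    inner ℝ (starF n D u) X = ∑ b, if D u b then X (u, b) else 0 := by
  simp only [PiLp.inner_apply, starF]
  rw [← Finset.univ_product_univ, Finset.sum_product, Finset.sum_eq_single u]
  · refine Finset.sum_congr rfl fun b _ => ?_
    simp
  · intro a _ ha
    simp [ha]
  · simp

lemma starF_norm (n : ℕ) (D : Fin n → Fin n → Prop) [DecidableRel D] (u : Fin n) :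
    ‖starF n D u‖ ^ 2 = ∑ b, if D u b then (1 : ℝ) else 0 := by
  rw [← real_inner_self_eq_norm_sq, starF_inner]
  refine Finset.sum_congr rfl fun b _ => ?_
  simp [starF]

lemma starZ_norm (n : ℕ) (D : Fin n → Fin n → Prop) [DecidableRel D] (u : Fin n)
    (hD' : ∀ a b, D a b → ¬ D b a) :
    ‖starZ n D u‖ ^ 2 = (∑ b, if D u b then (1 : ℝ) else 0) ^ 2
      + ∑ b, if D u b then (1 : ℝ) else 0 := by
  rw [EuclideanSpace.norm_sq_eq]
  have h : (∑ b, if D u b then (1 : ℝ) else 0) ^ 2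
      = ∑ c, if c = u then (∑ b, if D u b then (1 : ℝ) else 0) ^ 2 else 0 := by simp
  rw [h, ← Finset.sum_add_distrib]
  refine Finset.sum_congr rfl fun c _ => ?_
  have huu : ¬ D u u := fun h => hD' u u h h
  simp only [starZ, Real.norm_eq_abs, sq_abs]
  by_cases hc : c = u
  · subst hc; simp [huu]
  · simp [hc]

lemma star_inc (n : ℕ) (D : Fin n → Fin n → Prop) [DecidableRel D] (u : Fin n)
    (hD' : ∀ a b, D a b → ¬ D b a) :
    inner ℝ (starF n D u) (incMap n D (starZ n D u)) =
      (∑ b, if D u b then (1 : ℝ) else 0) * ((∑ b, if D u b then (1 : ℝ) else 0) + 1) := by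
  have huu : ¬ D u u := fun h => hD' u u h h
  rw [starF_inner, Finset.sum_mul]
  refine Finset.sum_congr rfl fun b _ => ?_
  by_cases hb : D u b
  · have : b ≠ u := fun h => huu (h ▸ hb)
    simp [hb, incMap, starZ, this, huu]
  · simp [hb]

noncomputable def restF (n : ℕ) (D : Fin n → Fin n → Prop) [DecidableRel D]
    (U : Finset (Fin n)) (y : EuclideanSpace ℝ (Fin n)) :
    EuclideanSpace ℝ (Fin n × Fin n) :=
  WithLp.toLp 2 fun p => if p.1 ∈ U then 0 else if D p.1 p.2 then y p.1 - y p.2 else 0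

lemma restF_norm (n : ℕ) (G : SimpleGraph (Fin n)) [DecidableRel G.Adj]
    (D : Fin n → Fin n → Prop) [DecidableRel D]
    (hD : ∀ a b, G.Adj a b ↔ D a b ∨ D b a) (hD' : ∀ a b, D a b → ¬ D b a)
    (U : Finset (Fin n)) (hDU : ∀ a b, D a b → b ∈ U → a ∈ U)
    (y : EuclideanSpace ℝ (Fin n)) :
    ‖restF n D U y‖ ^ 2
      = (∑ a ∈ Uᶜ, ∑ b ∈ Uᶜ, if G.Adj a b then (y a - y b) ^ 2 else 0) / 2 := by
  rw [← orient_sum G D hD hD' Uᶜ (fun a b => (y a - y b) ^ 2) (fun a b => by ring),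
    EuclideanSpace.norm_sq_eq, ← Finset.sum_product']
  symm
  apply Finset.sum_subset_zero_on_sdiff (Finset.subset_univ _)
  · intro p hp
    simp only [Finset.mem_sdiff, Finset.mem_univ, true_and, Finset.mem_product,
      Finset.mem_compl] at hp
    have := hDU p.1 p.2
    simp only [restF]
    split_ifs
    · simp
    · exfalso; tauto
    · simp
  · intro p hp
    simp only [Finset.mem_product, Finset.mem_compl] at hp
    simp only [restF, hp.1, if_false, Real.norm_eq_abs, sq_abs]
    split_ifs <;> simp

lemma restF_inc (n : ℕ) (D : Fin n → Fin n → Prop) [DecidableRel D]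
    (U : Finset (Fin n)) (y : EuclideanSpace ℝ (Fin n)) :
    inner ℝ (restF n D U y) (incMap n D y) = ‖restF n D U y‖ ^ 2 := by
  rw [← real_inner_self_eq_norm_sq]
  simp only [PiLp.inner_apply, restF, incMap]
  refine Finset.sum_congr rfl fun p _ => ?_
  split_ifs <;> simp [*] <;> ring

theorem stmt11 (n : ℕ) (hn : 2 < n) (G : SimpleGraph (Fin n)) [DecidableRel G.Adj]
    (hconn : G.Connected)
    (hL : (G.lapMatrix ℝ).IsHermitian)
    (lam : Fin n → ℝ) (σ : Equiv.Perm (Fin n))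
    (hlam : lam = hL.eigenvalues ∘ σ)
    (hlamAnti : ∀ i j : Fin n, i ≤ j → lam j ≤ lam i)
    (U : Finset (Fin n)) (m : ℕ) (hU : U.card = m) (hmn : m < n)
    [DecidableRel (SimpleGraph.induce ((↑U : Set (Fin n))ᶜ) G).Adj]
    (hL' : ((SimpleGraph.induce ((↑U : Set (Fin n))ᶜ) G).lapMatrix ℝ).IsHermitian)
    (θ1 : ℝ)
    (hθmem : ∃ i, hL'.eigenvalues i = θ1)
    (hθtop : ∀ i, hL'.eigenvalues i ≤ θ1) :
    (∑ u ∈ U, (G.degree u : ℝ)) + (m : ℝ) -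
      (((Finset.univ : Finset (Fin n × Fin n)).filter
        (fun p => p.1 ∈ U ∧ p.2 ∈ U ∧ G.Adj p.1 p.2)).card : ℝ) / 2 + θ1 ≤
      ∑ i ∈ Finset.filter (fun i : Fin n => (i : ℕ) < m + 1) Finset.univ, lam i := by
  classical
  obtain ⟨D, hD, hD', hDU, hDpos⟩ := exists_orient n G hconn U (hU ▸ hmn)
  have hA : ∀ i j, inner ℝ (incMap n D ((hL.eigenvectorBasis.reindex σ.symm) i))
      (incMap n D ((hL.eigenvectorBasis.reindex σ.symm) j)) = if i = j then lam i else 0 := by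
    intro i j
    rw [incMap_inner n G D hD hD', OrthonormalBasis.reindex_apply,
      OrthonormalBasis.reindex_apply, Matrix.IsHermitian.mulVec_eigenvectorBasis,
      dotProduct_smul, dotProduct_comm]
    have := orthonormal_iff_ite.1 hL.eigenvectorBasis.orthonormal (σ i) (σ j)
    rw [EuclideanSpace.inner_eq_star_dotProduct] at this
    simp at this
    simp [this, hlam]
    split_ifs with h
    · rw [h]
    · rfl
  have hapos : ∀ u ∈ U, 0 < ∑ b, if D u b then (1 : ℝ) else 0 := by
    intro u hu
    obtain ⟨b, hb⟩ := hDpos u hu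
    apply Finset.sum_pos' (fun i _ => by split_ifs <;> norm_num)
    exact ⟨b, Finset.mem_univ _, by simp [hb]⟩
  have hcount := star_count n G D hD hD' U hDU
  have hsum : ∑ u : U, ((∑ b, if D u b then (1 : ℝ) else 0) + 1) =
    (∑ u ∈ U, (G.degree u : ℝ)) + (m : ℝ) -
      (((Finset.univ : Finset (Fin n × Fin n)).filter
        (fun p => p.1 ∈ U ∧ p.2 ∈ U ∧ G.Adj p.1 p.2)).card : ℝ) / 2 := by
    rw [Finset.sum_coe_sort U (fun u => ((∑ b, if D u b then (1 : ℝ) else 0) + 1)),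
      Finset.sum_add_distrib, hcount]
    simp [hU]; ring
  have hF0 : ∀ u ∈ U, starF n D u ≠ 0 := by
    intro u hu h
    have h1 := starF_norm n D u
    have := hapos u hu
    rw [h, norm_zero] at h1
    nlinarith
  have hz0 : ∀ u ∈ U, starZ n D u ≠ 0 := by
    intro u hu h
    have h1 := starZ_norm n D u hD'
    have := hapos u hu
    rw [h, norm_zero] at h1
    nlinarith
  have hFF : ∀ u w, u ≠ w → inner ℝ (starF n D u) (starF n D w) = 0 := by
    intro u w h
    rw [starF_inner]
    simp [starF, h]
  have hbb : ∀ u, ((∑ b, if D u b then (1 : ℝ) else 0) + 1) *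
      (‖starF n D u‖ ^ 2 * ‖starZ n D u‖ ^ 2)
      ≤ (inner ℝ (starF n D u) (incMap n D (starZ n D u))) ^ 2 := by
    intro u
    rw [starF_norm, starZ_norm n D u hD', star_inc n D u hD']
    apply le_of_eq; ring
  obtain ⟨i0, hi0⟩ := hθmem
  set w := hL'.eigenvectorBasis i0 with hw
  have hwn : ‖w‖ = 1 := hL'.eigenvectorBasis.orthonormal.1 i0
  set y : EuclideanSpace ℝ (Fin n) := WithLp.toLp 2 fun a =>
    if h : a ∈ ((↑U : Set (Fin n))ᶜ) then w ⟨a, h⟩ else 0 with hy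
  have hyw : ∀ a : ((↑U : Set (Fin n))ᶜ : Set (Fin n)), y a = w a := by
    rintro ⟨a, ha⟩
    simp only [hy]
    rw [dif_pos ha]
  have hyn : ‖y‖ ^ 2 = 1 := by
    rw [← one_pow 2, ← hwn, EuclideanSpace.norm_sq_eq, EuclideanSpace.norm_sq_eq]
    rw [← Finset.sum_subset (Finset.subset_univ Uᶜ),
      Finset.sum_subtype (p := fun a => a ∈ ((↑U : Set (Fin n))ᶜ)) Uᶜ (by simp)]
    · exact Finset.sum_congr rfl fun a _ => by rw [hyw]
    · intro a _ ha
      simp at ha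
      simp [hy, ha]
  have hRn : ‖restF n D U y‖ ^ 2 = θ1 := by
    rw [restF_norm n G D hD hD' U hDU]
    have h1 := SimpleGraph.lapMatrix_toLinearMap₂' ℝ (SimpleGraph.induce ((↑U : Set (Fin n))ᶜ) G) w
    rw [Matrix.toLinearMap₂'_apply', Matrix.IsHermitian.mulVec_eigenvectorBasis,
      dotProduct_smul, hi0] at h1
    have h2 : (w : _ → ℝ) ⬝ᵥ w = 1 := by
      have := real_inner_self_eq_norm_sq w
      rw [EuclideanSpace.inner_eq_star_dotProduct, hwn] at this
      simpa using this
    rw [← hw, h2] at h1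
    rw [smul_eq_mul, mul_one] at h1
    rw [h1]
    congr 1
    rw [Finset.sum_subtype (p := fun a => a ∈ ((↑U : Set (Fin n))ᶜ)) Uᶜ (by simp)]
    refine Finset.sum_congr rfl fun a _ => ?_
    rw [Finset.sum_subtype (p := fun a => a ∈ ((↑U : Set (Fin n))ᶜ)) Uᶜ (by simp)]
    refine Finset.sum_congr rfl fun b _ => ?_
    rw [hyw, hyw]
    simp
  rw [← hsum]
  by_cases hθ : θ1 = 0
  · rw [hθ, add_zero]
    refine kyfan n m hmn (incMap n D) _ lam hlamAnti hA (fun u : U => starF n D u)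
      (fun u : U => starZ n D u) _ (fun u => hF0 u u.2) (fun u => hz0 u u.2)
      (fun u w h => hFF u w (fun h' => h (Subtype.ext h'))) (fun u => hbb u) ?_
    simp [hU]
  · have hR0 : restF n D U y ≠ 0 := by
      intro h
      rw [h] at hRn
      simp at hRn
      exact hθ hRn.symm
    have hy0 : y ≠ 0 := by
      intro h
      rw [h] at hyn
      simp at hyn
    have hFR : ∀ u ∈ U, inner ℝ (starF n D u) (restF n D U y) = 0 := by
      intro u hu
      rw [starF_inner]
      simp [restF, hu]
    have := kyfan (ι := Option U) n m hmn (incMap n D) _ lam hlamAnti hA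
      (fun o => o.elim (restF n D U y) (fun u => starF n D u))
      (fun o => o.elim y (fun u => starZ n D u))
      (fun o => o.elim θ1 (fun u => (∑ b, if D u b then (1 : ℝ) else 0) + 1))
      (by rintro (_ | u)
          · exact hR0
          · exact hF0 u u.2)
      (by rintro (_ | u)
          · exact hy0
          · exact hz0 u u.2)
      (by rintro (_ | u) (_ | w) h
          · exact absurd rfl h
          · simp only [Option.elim]
            rw [real_inner_comm]; exact hFR w w.2
          · exact hFR u u.2
          · exact hFF u w (fun h' => h (by rw [Subtype.ext h'])))
      (by rintro (_ | u)
          · simp only [Option.elim]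
            rw [restF_inc, hRn, hyn]
            apply le_of_eq; ring
          · exact hbb u)
      (by simp [hU])
    rw [Fintype.sum_option] at this
    simp only [Option.elim] at this
    linarith
end
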